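/- arXiv:1507.02531 — 4 statements merged into one kernel-verified Lean document; each statement's English description precedes it below -/
import Mathlib

section
/- G⟨E⟩ does not distribute over conjunction of properties: there exist a computation tree τ over input alphabet I = Bool and output alphabet O = Bool and linear-time properties A and G over Bool × Bool such that τ ⊨ G⟨E⟩A and τ ⊨ G⟨E⟩G, but τ does not satisfy G⟨E⟩(A ∧ G). (For instance, one may take A to be the traces whose inputs are eventually always true and G the traces whose inputs are eventually always false.) -/
/-- `w` is a trace of the computation tree `τ`: there is an input sequence `x`
such that at step `n` the output is `τ` applied to the first `n` inputs. -/
def IsTrace {I O : Type*} (τ : List I → O) (w : ℕ → I × O) : Prop :=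
  ∃ x : ℕ → I, ∀ n, w n = (x n, τ (List.ofFn (fun j : Fin n => x j)))

theorem GE_aux (b : Bool) (w : ℕ → Bool × Bool)
    (hw : IsTrace (fun _ : List Bool => true) w) (i : ℕ) :
    ∃ w', IsTrace (fun _ : List Bool => true) w' ∧
      w' ∈ {v : ℕ → Bool × Bool | ∃ N, ∀ n ≥ N, (v n).1 = b} ∧ ∀ j < i, w' j = w j := by
  obtain ⟨x, hx⟩ := hw
  refine ⟨fun n => (if n < i then x n else b, true), ⟨fun n => if n < i then x n else b,
    fun n => rfl⟩, ⟨i, fun n hn => ?_⟩, fun j hj => ?_⟩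
  · simp [Nat.not_lt.mpr hn]
  · simp [hj, hx]

theorem GE_not_distributive_over_inter :
    ∃ (τ : List Bool → Bool) (A G : Set (ℕ → Bool × Bool)),
      (∀ w, IsTrace τ w → ∀ i : ℕ,
        ∃ w', IsTrace τ w' ∧ w' ∈ A ∧ ∀ j < i, w' j = w j) ∧
      (∀ w, IsTrace τ w → ∀ i : ℕ,
        ∃ w', IsTrace τ w' ∧ w' ∈ G ∧ ∀ j < i, w' j = w j) ∧
      ¬ (∀ w, IsTrace τ w → ∀ i : ℕ,
        ∃ w', IsTrace τ w' ∧ w' ∈ A ∩ G ∧ ∀ j < i, w' j = w j) := by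
  refine ⟨fun _ => true, {v | ∃ N, ∀ n ≥ N, (v n).1 = true},
    {v | ∃ N, ∀ n ≥ N, (v n).1 = false}, GE_aux true, GE_aux false, fun h => ?_⟩
  obtain ⟨w, -, ⟨⟨N, hN⟩, ⟨M, hM⟩⟩, -⟩ := h (fun _ => (true, true)) ⟨fun _ => true, fun _ => rfl⟩ 0
  have h1 := hN (max N M) (le_max_left _ _)
  have h2 := hM (max N M) (le_max_right _ _)
  rw [h1] at h2
  exact Bool.noConfusion h2
end

section
/- (Bobble-tree lemma, G⟨E⟩ conjuncts) For every computation tree τ, every input prefix p : List I, and every linear-time property φ: if τ ⊨ G⟨E⟩φ, then the bobble language L'(τ, p) also satisfies G⟨E⟩φ, i.e., for every w ∈ L'(τ, p) and every i ∈ ℕ there exists w' ∈ L'(τ, p) with w' ∈ φ and w' j = w j for all j < i. Hence cutting a full computation tree into a bobble tree does not reduce the cooperation level for conjuncts of the form G⟨E⟩φ. -/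
/-- `w` is in the bobble language `L'(τ, p)`: a trace of `τ` whose first
`p.length` input components agree with the prefix `p`. -/
def InBobble {I O : Type*} (τ : List I → O) (p : List I) (w : ℕ → I × O) : Prop :=
  IsTrace τ w ∧ ∀ j : Fin p.length, (w j).1 = p.get j

theorem bobble_preserves_GE {I O : Type*} (τ : List I → O) (p : List I)
    (φ : Set (ℕ → I × O))
    (h : ∀ w, IsTrace τ w → ∀ i : ℕ,
      ∃ w', IsTrace τ w' ∧ w' ∈ φ ∧ ∀ j < i, w' j = w j) :
    ∀ w, InBobble τ p w → ∀ i : ℕ,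
      ∃ w', InBobble τ p w' ∧ w' ∈ φ ∧ ∀ j < i, w' j = w j := by
  rintro w ⟨hw, hp⟩ i
  obtain ⟨w', hw', hφ, hj⟩ := h w hw (max i p.length)
  refine ⟨w', ⟨hw', fun j => ?_⟩, hφ, fun j hji => hj j (lt_max_of_lt_left hji)⟩
  rw [hj j (lt_max_of_lt_right j.isLt)]
  exact hp j
end

section
/- (Bobble-tree lemma, general form) Let τ be a computation tree, p : List I an input prefix, and let Φ and Ψ be finite families of linear-time properties. If τ satisfies the cooperation level specification consisting of the conjuncts φ for every φ ∈ Φ and G⟨E⟩ψ for every ψ ∈ Ψ, then the bobble language L'(τ, p) satisfies the same specification: every word of L'(τ, p) lies in each φ ∈ Φ, and for every ψ ∈ Ψ, every w ∈ L'(τ, p), and every i ∈ ℕ there exists w' ∈ L'(τ, p) with w' ∈ ψ and w' j = w j for all j < i. -/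
theorem bobble_preserves_cooperation_level {I O : Type*}
    (τ : List I → O) (p : List I)
    (Φ Ψ : Finset (Set (ℕ → I × O)))
    (hΦ : ∀ φ ∈ Φ, ∀ w, IsTrace τ w → w ∈ φ)
    (hΨ : ∀ ψ ∈ Ψ, ∀ w, IsTrace τ w → ∀ i : ℕ,
      ∃ w', IsTrace τ w' ∧ w' ∈ ψ ∧ ∀ j < i, w' j = w j) :
    (∀ φ ∈ Φ, ∀ w, InBobble τ p w → w ∈ φ) ∧
    (∀ ψ ∈ Ψ, ∀ w, InBobble τ p w → ∀ i : ℕ,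
      ∃ w', InBobble τ p w' ∧ w' ∈ ψ ∧ ∀ j < i, w' j = w j) := by
  refine ⟨fun φ hφ w hw => hΦ φ hφ w hw.1, fun ψ hψ w hw i => ?_⟩
  obtain ⟨w', ht, hm, he⟩ := hΨ ψ hψ w hw.1 (max i p.length)
  refine ⟨w', ⟨ht, fun j => ?_⟩, hm, fun j hj => he j (lt_max_of_lt_left hj)⟩
  rw [he j (lt_max_of_lt_right j.isLt)]
  exact hw.2 j
end

section
/- The cooperation level 'G together with G⟨E⟩A' is strictly weaker than 'G together with A': there exist a computation tree τ over input alphabet I = Bool and output alphabet O = Bool and linear-time properties A and G over Bool × Bool such that τ ⊨ G (every trace of τ lies in G) and τ ⊨ G⟨E⟩A, but τ does not satisfy A (some trace of τ lies outside A). -/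
theorem guar_GE_assum_strictly_weaker :
    ∃ (τ : List Bool → Bool) (A G : Set (ℕ → Bool × Bool)),
      (∀ w, IsTrace τ w → w ∈ G) ∧
      (∀ w, IsTrace τ w → ∀ i : ℕ,
        ∃ w', IsTrace τ w' ∧ w' ∈ A ∧ ∀ j < i, w' j = w j) ∧
      ¬ (∀ w, IsTrace τ w → w ∈ A) := by
  refine ⟨fun _ => false, {w | ∃ n, (w n).1 = true}, Set.univ, fun _ _ => trivial, ?_, ?_⟩
  · rintro w ⟨x, hx⟩ i
    refine ⟨fun n => (if n < i then x n else true, false), ⟨_, fun n => rfl⟩, ⟨i, by simp⟩, ?_⟩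
    intro j hj
    simp [hx, hj]
  · intro h
    obtain ⟨n, hn⟩ := h (fun _ => (false, false)) ⟨fun _ => false, fun _ => rfl⟩
    simp at hn
end
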